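/- arXiv:2307.14048 — 2 statements merged into one kernel-verified Lean document; each statement's English description precedes it below -/
import Mathlib

section
/- Let d = 2^r − 2 with r ≥ 7. Then for all integers n ≥ d+7, q_d^{(2)}(n) ≥ Q_d^{(2)}(n). -/
/-- `qNum a d n` is the number of partitions of `n` into parts each at least `a`
in which any two parts differ by at least `d`. -/
noncomputable def qNum (a d n : ℕ) : ℕ :=
  Nat.card {p : n.Partition //
    (∀ x ∈ p.parts, a ≤ x) ∧
    p.parts.Pairwise (fun x y => d ≤ max x y - min x y)}

/-- `QNum b d n` is the number of partitions of `n` into parts congruent to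
`b` or `-b` modulo `d + 3`. -/
noncomputable def QNum (b d n : ℕ) : ℕ :=
  Nat.card {p : n.Partition //
    ∀ x ∈ p.parts, x % (d + 3) = b % (d + 3) ∨ (x + b) % (d + 3) = 0}

theorem card_partition_eq_ncard (n : ℕ) (P : Multiset ℕ → Prop) :
    Nat.card {p : n.Partition // P p.parts} =
      {s : Multiset ℕ | (∀ x ∈ s, 0 < x) ∧ s.sum = n ∧ P s}.ncard := by
  have hinj : Function.Injective (fun p : n.Partition => p.parts) := fun p q h =>
    Nat.Partition.ext h
  have h1 : Nat.card {p : n.Partition // P p.parts} = {p : n.Partition | P p.parts}.ncard := rfl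
  rw [h1, ← Set.ncard_image_of_injective _ hinj]
  congr 1
  ext s
  constructor
  · rintro ⟨p, hp, rfl⟩
    exact ⟨fun x hx => p.parts_pos hx, p.parts_sum, hp⟩
  · rintro ⟨h0, h1, h2⟩
    exact ⟨⟨s, fun hx => h0 _ hx, h1⟩, h2, rfl⟩

theorem finite_multiset_sum_eq (n : ℕ) :
    {s : Multiset ℕ | (∀ x ∈ s, 0 < x) ∧ s.sum = n}.Finite := by
  refine (Set.finite_range (fun p : n.Partition => p.parts)).subset ?_
  rintro s ⟨h0, h1⟩
  exact ⟨⟨s, fun hx => h0 _ hx, h1⟩, rfl⟩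

/-- The multisets of `k` numbers, each at least `a` and any two at least `d` apart, with sum `n`. -/
def gapped (d k a n : ℕ) : Set (Multiset ℕ) :=
  {s | s.card = k ∧ (∀ x ∈ s, a ≤ x) ∧
    s.Pairwise (fun x y => d ≤ max x y - min x y) ∧ s.sum = n}

theorem gapped_finite {a : ℕ} (ha : 0 < a) (d k n : ℕ) : (gapped d k a n).Finite :=
  (finite_multiset_sum_eq n).subset fun _ hs => ⟨fun x hx => ha.trans_le (hs.2.1 x hx), hs.2.2.2⟩

theorem singleton_mem_gapped {d a n : ℕ} (h : a ≤ n) : {n} ∈ gapped d 1 a n :=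
  ⟨by simp, by simpa using h, ⟨[n], rfl, by simp⟩, by simp⟩

theorem cons_mem_gapped {d k a n : ℕ} {s : Multiset ℕ} (hs : s ∈ gapped d k (a + d) n) :
    a ::ₘ s ∈ gapped d (k + 1) a (n + a) := by
  obtain ⟨hc, ha, ⟨l, rfl, hl⟩, hsum⟩ := hs
  refine ⟨by simpa using hc, ?_, ⟨a :: l, rfl, ?_⟩, ?_⟩
  · intro x hx
    rcases Multiset.mem_cons.1 hx with rfl | hx
    · exact le_rfl
    · have := ha x hx
      omega
  · refine List.pairwise_cons.2 ⟨fun x hx => ?_, hl⟩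
    have := ha x (Multiset.mem_coe.2 hx)
    omega
  · rw [Multiset.sum_cons, hsum, add_comm]

theorem ncard_gapped_add_le {a : ℕ} (ha : 0 < a) (d k n : ℕ) :
    (gapped d k (a + d) n).ncard + (gapped d (k + 1) (a + 1) (n + a)).ncard ≤
      (gapped d (k + 1) a (n + a)).ncard := by
  have hdisj : Disjoint ((fun s => a ::ₘ s) '' gapped d k (a + d) n)
      (gapped d (k + 1) (a + 1) (n + a)) := by
    rw [Set.disjoint_left]
    rintro _ ⟨s, -, rfl⟩ hs
    have := hs.2.1 a (Multiset.mem_cons_self a s)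
    omega
  have hinj : Function.Injective (fun s : Multiset ℕ => a ::ₘ s) := fun s t h =>
    (Multiset.cons_inj_right a).1 h
  rw [← Set.ncard_image_of_injective _ hinj,
    ← Set.ncard_union_eq hdisj ((gapped_finite (by omega) _ _ _).image _)
      (gapped_finite (by omega) _ _ _)]
  refine Set.ncard_le_ncard ?_ (gapped_finite ha _ _ _)
  rintro s (⟨t, ht, rfl⟩ | hs)
  · exact cons_mem_gapped ht
  · exact ⟨hs.1, fun x hx => (Nat.le_succ a).trans (hs.2.1 x hx), hs.2.2⟩

theorem add_pow_le_pow_add_mul (s c m : ℕ) :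
    (s + c) ^ (m + 1) ≤ s ^ (m + 1) + (m + 1) * c * (s + c) ^ m := by
  induction m with
  | zero => simp
  | succ m ih =>
    have h : s * s ^ (m + 1) + s * ((m + 1) * c * (s + c) ^ m) ≤
        s ^ (m + 2) + (s + c) * ((m + 1) * c * (s + c) ^ m) := by
      have := Nat.zero_le (c * ((m + 1) * c * (s + c) ^ m))
      rw [add_mul, pow_succ' s (m + 1)]
      linarith
    calc (s + c) ^ (m + 1 + 1) = s * (s + c) ^ (m + 1) + c * (s + c) ^ (m + 1) := by ring
      _ ≤ s * (s ^ (m + 1) + (m + 1) * c * (s + c) ^ m) + c * (s + c) ^ (m + 1) := by gcongr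
      _ ≤ s ^ (m + 2) + (s + c) * ((m + 1) * c * (s + c) ^ m) + c * (s + c) ^ (m + 1) := by
        rw [mul_add]
        omega
      _ = s ^ (m + 1 + 1) + (m + 1 + 1) * c * (s + c) ^ (m + 1) := by ring

open Nat in
theorem pow_le_mul_ncard_gapped (d k : ℕ) : ∀ t a n : ℕ, 0 < a →
    n = t + (k + 1) * a + d * (k + 1).choose 2 →
    t ^ k ≤ (k + 1)! * k ! * (gapped d (k + 1) a n).ncard := by
  induction k with
  | zero =>
    rintro t a n ha rfl
    have : 0 < (gapped d 1 a (t + (0 + 1) * a + d * (0 + 1).choose 2)).ncard :=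
      (Set.ncard_pos (gapped_finite ha _ _ _)).2 ⟨_, singleton_mem_gapped (by simp)⟩
    simpa [Nat.one_le_iff_ne_zero, Nat.pos_iff_ne_zero] using this
  | succ k ih =>
    intro t
    induction t using Nat.strong_induction_on with
    | _ t iht =>
      intro a n ha hn
      have hch : (k + 1 + 1).choose 2 = (k + 1) + (k + 1).choose 2 := by
        rw [Nat.choose_succ_succ' (k + 1) 1, Nat.choose_one_right]
      obtain ⟨m, rfl⟩ : ∃ m, n = m + a := ⟨n - a, by
        have : a ≤ (k + 1 + 1) * a := Nat.le_mul_of_pos_left a (by omega)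
        omega⟩
      have h1 := ih t (a + d) m (by omega) (by rw [hch] at hn; linarith)
      have h2 := ncard_gapped_add_le ha d (k + 1) m
      have h3 : t ^ (k + 1) ≤ (k + 1) * (k + 2) * t ^ k +
          (k + 2)! * (k + 1)! * (gapped d (k + 1 + 1) (a + 1) (m + a)).ncard := by
        rcases lt_or_ge t (k + 2) with ht | ht
        · calc t ^ (k + 1) = 1 * t * t ^ k := by ring
            _ ≤ (k + 1) * (k + 2) * t ^ k := by gcongr; omega
            _ ≤ _ := Nat.le_add_right _ _
        · obtain ⟨s, rfl⟩ := Nat.exists_eq_add_of_le' ht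
          have h4 := iht s (by omega) (a + 1) (m + a) (by omega) (by rw [hn]; ring)
          have h5 := add_pow_le_pow_add_mul s (k + 2) k
          linarith
      calc t ^ (k + 1) ≤ _ := h3
        _ ≤ (k + 1) * (k + 2) * ((k + 1)! * k ! * (gapped d (k + 1) (a + d) m).ncard) +
          (k + 2)! * (k + 1)! * (gapped d (k + 1 + 1) (a + 1) (m + a)).ncard := by gcongr
        _ = (k + 2)! * (k + 1)! * ((gapped d (k + 1) (a + d) m).ncard +
          (gapped d (k + 1 + 1) (a + 1) (m + a)).ncard) := by
          rw [Nat.factorial_succ (k + 1), Nat.factorial_succ k]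
          ring
        _ ≤ _ := by gcongr

theorem qNum_eq_ncard {a : ℕ} (ha : 0 < a) (d n : ℕ) :
    qNum a d n = (⋃ k, gapped d k a n).ncard := by
  unfold qNum
  rw [card_partition_eq_ncard n (fun s => (∀ x ∈ s, a ≤ x) ∧
    s.Pairwise (fun x y => d ≤ max x y - min x y))]
  congr 1
  ext s
  simp only [gapped, Set.mem_ofPred_eq, Set.mem_iUnion, exists_eq_left']
  exact ⟨fun h => ⟨h.2.2.1, h.2.2.2, h.2.1⟩,
    fun h => ⟨fun x hx => ha.trans_le (h.1 x hx), h.2.2, h.1, h.2.1⟩⟩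

theorem iUnion_gapped_finite {a : ℕ} (ha : 0 < a) (d n : ℕ) : (⋃ k, gapped d k a n).Finite := by
  refine (finite_multiset_sum_eq n).subset (Set.iUnion_subset fun k s hs => ?_)
  exact ⟨fun x hx => ha.trans_le (hs.2.1 x hx), hs.2.2.2⟩

theorem ncard_gapped_le_qNum {a : ℕ} (ha : 0 < a) (d k n : ℕ) :
    (gapped d k a n).ncard ≤ qNum a d n := by
  rw [qNum_eq_ncard ha]
  exact Set.ncard_le_ncard (Set.subset_iUnion (fun k => gapped d k a n) k)
    (iUnion_gapped_finite ha d n)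

/-- The number of multisets of indices below `j` of total weight at most `N`, where the index `i`
has weight `i / 2 + 1`; each positive weight belongs to exactly two indices. -/
def weightCount : ℕ → ℕ → ℕ
  | 0, _ => 1
  | j + 1, N => ∑ m ∈ Finset.range (N / (j / 2 + 1) + 1), weightCount j (N - m * (j / 2 + 1))

theorem weightCount_succ_of_lt {j N : ℕ} (h : N < j / 2 + 1) :
    weightCount (j + 1) N = weightCount j N := by
  simp [weightCount, Nat.div_eq_of_lt h]

theorem weightCount_succ_of_le {j N : ℕ} (h : j / 2 + 1 ≤ N) :
    weightCount (j + 1) N = weightCount j N + weightCount (j + 1) (N - (j / 2 + 1)) := by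
  obtain ⟨M, rfl⟩ := Nat.exists_eq_add_of_le' h
  rw [weightCount, Finset.sum_range_succ', Nat.add_div_right _ (Nat.succ_pos _), weightCount,
    add_comm]
  congr 1
  · simp
  · simp only [Nat.add_sub_cancel]
    refine Finset.sum_congr rfl fun m _ => ?_
    congr 1
    rw [add_mul, one_mul]
    omega

theorem encard_le_weightCount (j : ℕ) : ∀ N : ℕ,
    {s : Multiset ℕ | (∀ i ∈ s, i < j) ∧ (s.map fun i => i / 2 + 1).sum ≤ N}.encard ≤
      weightCount j N := by
  induction j with
  | zero =>
    intro N
    have : {s : Multiset ℕ | (∀ i ∈ s, i < 0) ∧ (s.map fun i => i / 2 + 1).sum ≤ N} ⊆ {0} := by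
      rintro s ⟨hs, -⟩
      exact Multiset.eq_zero_of_forall_notMem fun i hi => absurd (hs i hi) (Nat.not_lt_zero i)
    refine (Set.encard_le_encard this).trans ?_
    simp [weightCount]
  | succ j ih =>
    intro N
    induction N using Nat.strong_induction_on with
    | _ N ihN =>
      have key : ∀ s : Multiset ℕ, (∀ i ∈ s, i < j + 1) → j ∉ s → ∀ i ∈ s, i < j := by
        intro s hs hj i hi
        have := hs i hi
        have : i ≠ j := by rintro rfl; exact hj hi
        omega
      rcases lt_or_ge N (j / 2 + 1) with h | h
      · rw [weightCount_succ_of_lt h]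
        refine (Set.encard_le_encard ?_).trans (ih N)
        rintro s ⟨hs, hsum⟩
        refine ⟨key s hs fun hj => ?_, hsum⟩
        have := Multiset.single_le_sum (fun _ _ => Nat.zero_le _) _
          (Multiset.mem_map_of_mem (fun i => i / 2 + 1) hj)
        omega
      · rw [weightCount_succ_of_le h, Nat.cast_add]
        refine le_trans ?_ (add_le_add (ih N) (ihN (N - (j / 2 + 1)) (by omega)))
        refine le_trans ?_ (add_le_add le_rfl (Set.encard_image_le (fun s => j ::ₘ s) _))
        refine le_trans (Set.encard_le_encard ?_) (Set.encard_union_le _ _)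
        rintro s ⟨hs, hsum⟩
        by_cases hj : j ∈ s
        · right
          obtain ⟨t, rfl⟩ := Multiset.exists_cons_of_mem hj
          refine ⟨t, ⟨fun i hi => hs i (Multiset.mem_cons_of_mem hi), ?_⟩, rfl⟩
          rw [Multiset.map_cons, Multiset.sum_cons] at hsum
          omega
        · exact Or.inl ⟨key s hs hj, hsum⟩

/-- The position of `x` in the increasing list of the numbers above `2` that are congruent to
`2` or `-2` modulo `d + 3`. -/
def residueIndex (d x : ℕ) : ℕ :=
  if x % (d + 3) = 2 then 2 * (x / (d + 3)) - 1 else 2 * (x / (d + 3))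

theorem exists_eq_of_residue {d x : ℕ} (hd : 2 ≤ d) (hx2 : x ≠ 2)
    (h : x % (d + 3) = 2 % (d + 3) ∨ (x + 2) % (d + 3) = 0) :
    ∃ i, (x = i * (d + 3) + (d + 1) ∧ residueIndex d x = 2 * i) ∨
      (x = (i + 1) * (d + 3) + 2 ∧ residueIndex d x = 2 * i + 1) := by
  have hx := Nat.div_add_mod' x (d + 3)
  rw [Nat.mod_eq_of_lt (show 2 < d + 3 by omega)] at h
  rcases h with h | h
  · have h0 : x / (d + 3) ≠ 0 := by
      intro h0
      rw [h0, h] at hx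
      omega
    obtain ⟨i, hi⟩ := Nat.exists_eq_succ_of_ne_zero h0
    refine ⟨i, Or.inr ⟨?_, ?_⟩⟩
    · rw [hi, h] at hx
      exact hx.symm
    · rw [residueIndex, if_pos h, hi]
      omega
  · obtain ⟨c, hc⟩ := Nat.dvd_of_mod_eq_zero h
    have hc0 : c ≠ 0 := by
      rintro rfl
      omega
    obtain ⟨i, rfl⟩ := Nat.exists_eq_succ_of_ne_zero hc0
    have hxi : x = (d + 1) + (d + 3) * i := by
      rw [Nat.succ_eq_add_one, mul_add] at hc
      omega
    have hmod : x % (d + 3) = d + 1 := by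
      rw [hxi, Nat.add_mul_mod_self_left, Nat.mod_eq_of_lt (by omega)]
    have hdiv : x / (d + 3) = i := by
      rw [hxi, Nat.add_mul_div_left _ _ (by omega), Nat.div_eq_of_lt (by omega), zero_add]
    refine ⟨i, Or.inl ⟨by rw [hxi]; ring, ?_⟩⟩
    rw [residueIndex, if_neg (by omega), hdiv]

theorem residueIndex_injOn {d : ℕ} (hd : 2 ≤ d) :
    Set.InjOn (residueIndex d)
      {x | x ≠ 2 ∧ (x % (d + 3) = 2 % (d + 3) ∨ (x + 2) % (d + 3) = 0)} := by
  rintro x ⟨hx2, hx⟩ y ⟨hy2, hy⟩ hxy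
  obtain ⟨i, hi⟩ := exists_eq_of_residue hd hx2 hx
  obtain ⟨k, hk⟩ := exists_eq_of_residue hd hy2 hy
  rcases hi with ⟨hi, hi'⟩ | ⟨hi, hi'⟩ <;> rcases hk with ⟨hk, hk'⟩ | ⟨hk, hk'⟩ <;>
    rw [hi', hk'] at hxy
  · obtain rfl : i = k := by omega
    rw [hi, hk]
  · omega
  · omega
  · obtain rfl : i = k := by omega
    rw [hi, hk]

theorem mul_residueIndex_le {d x : ℕ} (hd : 2 ≤ d) (hx2 : x ≠ 2)
    (h : x % (d + 3) = 2 % (d + 3) ∨ (x + 2) % (d + 3) = 0) :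
    (d + 1) * (residueIndex d x / 2 + 1) ≤ x := by
  obtain ⟨i, ⟨hi, hi'⟩ | ⟨hi, hi'⟩⟩ := exists_eq_of_residue hd hx2 h
  · rw [hi', hi, Nat.mul_div_cancel_left _ (by norm_num)]
    nlinarith
  · rw [hi', hi, show (2 * i + 1) / 2 = i by omega]
    nlinarith

theorem multiset_map_injOn {α β : Type*} {f : α → β} {T : Set α} (hf : Set.InjOn f T) :
    Set.InjOn (Multiset.map f) {s | ∀ x ∈ s, x ∈ T} := by
  rcases isEmpty_or_nonempty α with hα | hα
  · intro s _ t _ _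
    exact Subsingleton.elim s t
  · have key : ∀ s : Multiset α, (∀ x ∈ s, x ∈ T) →
        (s.map f).map (Function.invFunOn f T) = s := by
      intro s hs
      rw [Multiset.map_map]
      conv_rhs => rw [← Multiset.map_id s]
      exact Multiset.map_congr rfl fun x hx => hf.leftInvOn_invFunOn (hs x hx)
    intro s hs t ht hst
    rw [← key s hs, ← key t ht, hst]

theorem QNum_le_weightCount {d n : ℕ} (hd : 2 ≤ d) :
    QNum 2 d n ≤ weightCount (2 * (n / (d + 1))) (n / (d + 1)) := by
  set N := n / (d + 1) with hN
  unfold QNum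
  rw [card_partition_eq_ncard n
    (fun s => ∀ x ∈ s, x % (d + 3) = 2 % (d + 3) ∨ (x + 2) % (d + 3) = 0)]
  refine ENat.natCast_le_natCast.1
    ((Set.ncard_le_encard _).trans (le_trans ?_ (encard_le_weightCount _ N)))
  set F : Multiset ℕ → Multiset ℕ := fun s => (s.filter (· ≠ 2)).map (residueIndex d) with hF
  have hbase : ∀ s : Multiset ℕ,
      (∀ x ∈ s, x % (d + 3) = 2 % (d + 3) ∨ (x + 2) % (d + 3) = 0) →
      ∀ x ∈ s.filter (· ≠ 2),
        x ≠ 2 ∧ (x % (d + 3) = 2 % (d + 3) ∨ (x + 2) % (d + 3) = 0) := fun s hs x hx =>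
    ⟨(Multiset.mem_filter.1 hx).2, hs x (Multiset.mem_filter.1 hx).1⟩
  have hsplit : ∀ s : Multiset ℕ, s = Multiset.replicate (s.count 2) 2 + s.filter (· ≠ 2) := by
    intro s
    conv_lhs => rw [← Multiset.filter_add_not (· = 2) s, Multiset.filter_eq']
  refine Set.encard_le_encard_of_injOn (f := F) ?_ ?_
  · rintro s ⟨-, hsum, hs⟩
    have hle : (s.filter (· ≠ 2)).sum ≤ n := by
      rw [hsplit s, Multiset.sum_add] at hsum
      omega
    have hw : ((F s).map fun i => i / 2 + 1).sum ≤ N := by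
      rw [hN, Nat.le_div_iff_mul_le (by omega), mul_comm]
      refine le_trans ?_ hle
      rw [hF, Multiset.map_map, ← Multiset.sum_map_mul_left]
      conv_rhs => rw [← Multiset.map_id (s.filter (· ≠ 2))]
      refine Multiset.sum_map_le_sum_map _ _ fun x hx => ?_
      exact mul_residueIndex_le hd (hbase s hs x hx).1 (hbase s hs x hx).2
    refine ⟨fun i hi => ?_, hw⟩
    have := Multiset.single_le_sum (fun _ _ => Nat.zero_le _) _
      (Multiset.mem_map_of_mem (fun i => i / 2 + 1) hi)
    omega
  · rintro s ⟨-, hsum, hs⟩ t ⟨-, htum, ht⟩ hst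
    have hfil : s.filter (· ≠ 2) = t.filter (· ≠ 2) :=
      multiset_map_injOn (residueIndex_injOn hd) (hbase s hs) (hbase t ht) hst
    have hcount : s.count 2 = t.count 2 := by
      rw [hsplit s, Multiset.sum_add, Multiset.sum_replicate, smul_eq_mul] at hsum
      rw [hsplit t, Multiset.sum_add, Multiset.sum_replicate, smul_eq_mul, ← hfil] at htum
      omega
    rw [hsplit s, hsplit t, hfil, hcount]

theorem weightCount_le_exp_mul_prod {y : ℝ} (hy : 0 < y) (j : ℕ) : ∀ N : ℕ,
    (weightCount j N : ℝ) ≤ Real.exp (y * N) *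
      ∏ i ∈ Finset.range j, (1 - Real.exp (-(y * (i / 2 + 1 : ℕ))))⁻¹ := by
  induction j with
  | zero =>
    intro N
    simp only [weightCount, Finset.range_zero, Finset.prod_empty, mul_one, Nat.cast_one]
    exact Real.one_le_exp (by positivity)
  | succ j ih =>
    intro N
    rw [Finset.prod_range_succ]
    set P := ∏ i ∈ Finset.range j, (1 - Real.exp (-(y * (i / 2 + 1 : ℕ))))⁻¹
    set z := Real.exp (-(y * (j / 2 + 1 : ℕ))) with hz
    have hz0 : 0 < z := Real.exp_pos _
    have hz1 : z < 1 := Real.exp_lt_one_iff.2 (by simp only [neg_lt_zero]; positivity)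
    have hz2 : 0 < 1 - z := by linarith
    induction N using Nat.strong_induction_on with
    | _ N ihN =>
      have hjN := ih N
      rcases lt_or_ge N (j / 2 + 1) with h | h
      · rw [weightCount_succ_of_lt h]
        have h1 : (1 : ℝ) ≤ (1 - z)⁻¹ := (one_le_inv₀ hz2).2 (by linarith)
        calc (weightCount j N : ℝ) ≤ Real.exp (y * N) * P := hjN
          _ ≤ Real.exp (y * N) * P * (1 - z)⁻¹ :=
            le_mul_of_one_le_right ((Nat.cast_nonneg _).trans hjN) h1
          _ = _ := by ring
      · rw [weightCount_succ_of_le h, Nat.cast_add]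
        have h2 := ihN (N - (j / 2 + 1)) (by omega)
        have h3 : Real.exp (y * ((N - (j / 2 + 1) : ℕ) : ℝ)) = Real.exp (y * N) * z := by
          rw [hz, ← Real.exp_add, Nat.cast_sub h]
          congr 1
          ring
        rw [h3] at h2
        calc (weightCount j N : ℝ) + weightCount (j + 1) (N - (j / 2 + 1))
            ≤ Real.exp (y * N) * P + Real.exp (y * N) * z * (P * (1 - z)⁻¹) := add_le_add hjN h2
          _ = Real.exp (y * N) * (P * (1 - z)⁻¹) := by field_simp; ring

theorem prod_range_two_mul_div_two (f : ℕ → ℝ) (N : ℕ) :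
    ∏ i ∈ Finset.range (2 * N), f (i / 2 + 1) = (∏ i ∈ Finset.range N, f (i + 1)) ^ 2 := by
  induction N with
  | zero => simp
  | succ N ih =>
    rw [show 2 * (N + 1) = 2 * N + 1 + 1 by ring, Finset.prod_range_succ, Finset.prod_range_succ,
      ih, Finset.prod_range_succ, show (2 * N + 1) / 2 = N by omega,
      show 2 * N / 2 = N by omega]
    ring

theorem sum_exp_neg_mul_le {u : ℝ} (hu : 0 < u) (N : ℕ) :
    ∑ i ∈ Finset.range N, Real.exp (-(u * (i + 1 : ℕ))) ≤ 1 / u := by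
  have h1 : ∀ i : ℕ, Real.exp (-(u * (i + 1 : ℕ))) = Real.exp (-u) * Real.exp (-u) ^ i := by
    intro i
    rw [← Real.exp_nat_mul, ← Real.exp_add]
    congr 1
    push_cast
    ring
  simp only [h1]
  rw [← Finset.mul_sum]
  have hlt : Real.exp (-u) < 1 := Real.exp_lt_one_iff.2 (by linarith)
  have hpos := Real.exp_pos (-u)
  have hgeom : ∑ i ∈ Finset.range N, Real.exp (-u) ^ i ≤ (1 - Real.exp (-u))⁻¹ := by
    rw [← tsum_geometric_of_lt_one hpos.le hlt]
    exact (summable_geometric_of_lt_one hpos.le hlt).sum_le_tsum _ fun i _ => by positivity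
  refine (mul_le_mul_of_nonneg_left hgeom hpos.le).trans ?_
  rw [← div_eq_mul_inv, div_le_div_iff₀ (by linarith) hu]
  have h2 : Real.exp (-u) * (u + 1) ≤ 1 := by
    calc Real.exp (-u) * (u + 1) ≤ Real.exp (-u) * Real.exp u := by
          gcongr
          exact Real.add_one_le_exp u
      _ = 1 := by rw [← Real.exp_add]; simp
  linarith

theorem prod_inv_one_sub_exp_le {y : ℝ} (hy : 0 < y) (N : ℕ) :
    ∏ i ∈ Finset.range N, (1 - Real.exp (-(y * (i + 1 : ℕ))))⁻¹ ≤
      Real.exp (Real.pi ^ 2 / 6 / y) := by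
  have hlt : ∀ i : ℕ, Real.exp (-(y * (i + 1 : ℕ))) < 1 := fun i =>
    Real.exp_lt_one_iff.2 (by simp only [neg_lt_zero]; positivity)
  have hterm : ∀ i : ℕ, (1 - Real.exp (-(y * (i + 1 : ℕ))))⁻¹ =
      Real.exp (-Real.log (1 - Real.exp (-(y * (i + 1 : ℕ))))) := by
    intro i
    rw [Real.exp_neg (Real.log _), Real.exp_log (by linarith [hlt i])]
  simp only [hterm]
  rw [← Real.exp_sum, Real.exp_le_exp]
  have hsum : HasSum (fun m : ℕ => ∑ i ∈ Finset.range N,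
      Real.exp (-(y * (i + 1 : ℕ))) ^ (m + 1) / ((m : ℝ) + 1))
      (∑ i ∈ Finset.range N, -Real.log (1 - Real.exp (-(y * (i + 1 : ℕ))))) := by
    refine hasSum_sum fun i _ => Real.hasSum_pow_div_log_of_abs_lt_one ?_
    rw [abs_of_pos (Real.exp_pos _)]
    exact hlt i
  have hzeta : HasSum (fun m : ℕ => 1 / ((m + 1 : ℕ) : ℝ) ^ 2 / y) (Real.pi ^ 2 / 6 / y) := by
    refine HasSum.div_const ?_ y
    have := (hasSum_nat_add_iff' (f := fun m : ℕ => 1 / (m : ℝ) ^ 2) 1).2 hasSum_zeta_two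
    simpa using this
  refine hasSum_le (fun m => ?_) hsum hzeta
  have hu : 0 < y * (m + 1 : ℕ) := by positivity
  rw [← Finset.sum_div]
  have h1 : ∑ i ∈ Finset.range N, Real.exp (-(y * (i + 1 : ℕ))) ^ (m + 1) ≤
      1 / (y * (m + 1 : ℕ)) := by
    refine le_trans (le_of_eq ?_) (sum_exp_neg_mul_le hu N)
    refine Finset.sum_congr rfl fun i _ => ?_
    rw [← Real.exp_nat_mul]
    congr 1
    push_cast
    ring
  calc _ ≤ 1 / (y * (m + 1 : ℕ)) / ((m : ℝ) + 1) := by gcongr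
    _ = _ := by push_cast; field_simp

theorem weightCount_le_exp {N K : ℕ} (hK : 0 < K) (h : N ≤ K ^ 2) :
    (weightCount (2 * N) N : ℝ) ≤ Real.exp (11 / 3 * K) := by
  have hK' : (0 : ℝ) < K := by exact_mod_cast hK
  have hy : (0 : ℝ) < 2 / K := by positivity
  refine (weightCount_le_exp_mul_prod hy (2 * N) N).trans ?_
  rw [prod_range_two_mul_div_two (fun v : ℕ => (1 - Real.exp (-(2 / (K : ℝ) * (v : ℝ))))⁻¹) N]
  have hpos : 0 ≤ ∏ i ∈ Finset.range N, (1 - Real.exp (-(2 / (K : ℝ) * ((i + 1 : ℕ) : ℝ))))⁻¹ :=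
    Finset.prod_nonneg fun i _ => inv_nonneg.2 (sub_nonneg.2
      (Real.exp_le_one_iff.2 (by simp only [neg_nonpos]; positivity)))
  calc _ ≤ Real.exp (2 / K * N) * Real.exp (Real.pi ^ 2 / 6 / (2 / K)) ^ 2 := by
        gcongr
        exact prod_inv_one_sub_exp_le hy N
    _ = Real.exp (2 / K * N + 2 * (Real.pi ^ 2 / 6 / (2 / K))) := by
        rw [← Real.exp_nat_mul, ← Real.exp_add]
        norm_num
    _ ≤ _ := by
        rw [Real.exp_le_exp]
        have h1 : 2 / (K : ℝ) * N ≤ 2 * K := by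
          have : (N : ℝ) ≤ (K : ℝ) ^ 2 := by exact_mod_cast h
          rw [div_mul_eq_mul_div, div_le_iff₀ hK']
          nlinarith
        have h2 : Real.pi ^ 2 ≤ 10 := by nlinarith [Real.pi_lt_d2, Real.pi_pos]
        have h3 : 2 * (Real.pi ^ 2 / 6 / (2 / (K : ℝ))) = Real.pi ^ 2 / 6 * K := by
          field_simp
        rw [h3]
        nlinarith

open Nat in
theorem le_qNum_of_mul_le_pow {d n k t C : ℕ}
    (hn : t + (k + 1) * 2 + d * (k + 1).choose 2 ≤ n) (hC : (k + 1)! * k ! * C ≤ t ^ k) :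
    C ≤ qNum 2 d n := by
  obtain ⟨u, rfl⟩ := Nat.exists_eq_add_of_le hn
  have h := pow_le_mul_ncard_gapped d k (t + u) 2 _ two_pos
    (show t + (k + 1) * 2 + d * (k + 1).choose 2 + u =
      t + u + (k + 1) * 2 + d * (k + 1).choose 2 by ring)
  have h' : t ^ k ≤ (t + u) ^ k := Nat.pow_le_pow_left (Nat.le_add_right _ _) k
  refine le_trans ?_ (ncard_gapped_le_qNum two_pos d (k + 1) _)
  exact Nat.le_of_mul_le_mul_left (hC.trans (h'.trans h)) (by positivity)

theorem three_le_qNum {d n : ℕ} (hn : d + 7 ≤ n) : 3 ≤ qNum 2 d n := by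
  have h1 : 1 ≤ (gapped d 1 2 n).ncard :=
    (Set.ncard_pos (gapped_finite two_pos _ _ _)).2 ⟨_, singleton_mem_gapped (by omega)⟩
  have h2 := pow_le_mul_ncard_gapped d 1 (n - 4 - d) 2 n two_pos (by simp; omega)
  norm_num [Nat.factorial] at h2
  have hdisj : Disjoint (gapped d 1 2 n) (gapped d 2 2 n) := by
    rw [Set.disjoint_left]
    intro s hs ht
    have := hs.1.symm.trans ht.1
    omega
  rw [qNum_eq_ncard two_pos]
  calc 3 ≤ (gapped d 1 2 n).ncard + (gapped d 2 2 n).ncard := by omega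
    _ = (gapped d 1 2 n ∪ gapped d 2 2 n).ncard :=
      (Set.ncard_union_eq hdisj (gapped_finite two_pos _ _ _) (gapped_finite two_pos _ _ _)).symm
    _ ≤ _ := Set.ncard_le_ncard (Set.union_subset
        (Set.subset_iUnion (fun k => gapped d k 2 n) 1)
        (Set.subset_iUnion (fun k => gapped d k 2 n) 2)) (iUnion_gapped_finite two_pos d n)

theorem exp_natCast_le_pow (m : ℕ) : Real.exp m ≤ 2.7182818286 ^ m := by
  rw [← Real.exp_one_pow]
  exact pow_le_pow_left₀ (Real.exp_pos 1).le Real.exp_one_lt_d9.le m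

theorem three_mul_pow_le (k : ℕ) (hk : 0 < k) : 3 * k ^ k ≤ (k + 2) ^ k := by
  have hk' : (0 : ℝ) < k := by exact_mod_cast hk
  have h := one_add_mul_le_pow (a := 2 / (k : ℝ)) (by linarith [div_pos two_pos hk']) k
  have h1 : 1 + (k : ℝ) * (2 / k) = 3 := by field_simp; norm_num
  have h2 : (k + 2 : ℝ) ^ k = (1 + 2 / k) ^ k * k ^ k := by
    rw [← mul_pow]
    congr 1
    field_simp
  have h3 : (3 : ℝ) * k ^ k ≤ (k + 2) ^ k := by
    rw [h2, ← h1]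
    gcongr
  exact_mod_cast h3

open Nat in
theorem exp_mul_factorial_le_pow {k : ℕ} (hk : 4 ≤ k) :
    Real.exp (11 / 3 * (k + 2 : ℕ)) * ((k + 1)! * k ! : ℕ) ≤
      ((63 * (k + 1) * (k + 2)) ^ k : ℕ) := by
  induction k, hk using Nat.le_induction with
  | base =>
    have h := exp_natCast_le_pow 22
    have h' : Real.exp (11 / 3 * (4 + 2 : ℕ)) = Real.exp (22 : ℕ) := by
      congr 1
      norm_num
    rw [h']
    calc Real.exp (22 : ℕ) * ((4 + 1)! * 4 ! : ℕ) ≤ 2.7182818286 ^ 22 * ((4 + 1)! * 4 ! : ℕ) := by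
          gcongr
      _ ≤ _ := by norm_num [Nat.factorial]
  | succ k hk ih =>
    have hexp : Real.exp (11 / 3 * (k + 1 + 2 : ℕ)) ≤ 189 * Real.exp (11 / 3 * (k + 2 : ℕ)) := by
      have h1 : Real.exp (11 / 3 * (k + 1 + 2 : ℕ)) =
          Real.exp (11 / 3) * Real.exp (11 / 3 * (k + 2 : ℕ)) := by
        rw [← Real.exp_add]
        congr 1
        push_cast
        ring
      rw [h1]
      gcongr
      calc Real.exp (11 / 3) ≤ Real.exp (4 : ℕ) := Real.exp_le_exp.2 (by norm_num)
        _ ≤ 2.7182818286 ^ 4 := exp_natCast_le_pow 4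
        _ ≤ 189 := by norm_num
    have hpow : 189 * ((k + 1) * (k + 2)) * (63 * (k + 1) * (k + 2)) ^ k ≤
        (63 * (k + 1 + 1) * (k + 1 + 2)) ^ (k + 1) := by
      have h := three_mul_pow_le (k + 1) (Nat.succ_pos k)
      calc 189 * ((k + 1) * (k + 2)) * (63 * (k + 1) * (k + 2)) ^ k
          = 63 ^ (k + 1) * (k + 2) ^ (k + 1) * (3 * (k + 1) ^ (k + 1)) := by
            rw [mul_pow, mul_pow]
            ring
        _ ≤ 63 ^ (k + 1) * (k + 2) ^ (k + 1) * (k + 1 + 2) ^ (k + 1) := by gcongr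
        _ = _ := by rw [← mul_pow, ← mul_pow]
    calc Real.exp (11 / 3 * (k + 1 + 2 : ℕ)) * ((k + 1 + 1)! * (k + 1)! : ℕ)
        ≤ 189 * Real.exp (11 / 3 * (k + 2 : ℕ)) * ((k + 1 + 1)! * (k + 1)! : ℕ) := by gcongr
      _ = 189 * ((k + 1) * (k + 2)) *
          (Real.exp (11 / 3 * (k + 2 : ℕ)) * ((k + 1)! * k ! : ℕ)) := by
        rw [Nat.factorial_succ (k + 1), Nat.factorial_succ k]
        push_cast
        ring
      _ ≤ 189 * ((k + 1) * (k + 2)) * ((63 * (k + 1) * (k + 2)) ^ k : ℕ) := by gcongr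
      _ ≤ _ := by exact_mod_cast hpow

theorem weightCount_le_qNum_of_large {d n N : ℕ} (hd : 126 ≤ d) (hN : 25 ≤ N)
    (hn : N * (d + 1) ≤ n) : weightCount (2 * N) N ≤ qNum 2 d n := by
  obtain ⟨k, hk⟩ : ∃ k, N.sqrt = k + 1 :=
    Nat.exists_eq_succ_of_ne_zero (Nat.sqrt_pos.2 (by omega)).ne'
  have hlow : (k + 1) * (k + 1) ≤ N := hk ▸ Nat.sqrt_le N
  have hupp : N ≤ (k + 2) ^ 2 := by
    have := Nat.lt_succ_sqrt N
    rw [hk] at this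
    rw [sq]
    exact this.le
  have hk4 : 4 ≤ k := by
    have : 5 ≤ N.sqrt := Nat.le_sqrt.2 (by omega)
    omega
  refine le_qNum_of_mul_le_pow (k := k) (t := 63 * (k + 1) * (k + 2)) ?_ ?_
  · have hc : (k + 1).choose 2 * 2 = (k + 1) * k := by
      rw [Nat.choose_two_right, Nat.div_mul_cancel (Nat.even_mul_pred_self (k + 1)).two_dvd,
        Nat.add_sub_cancel]
    have h1 : (k + 1) * (k + 1) * (d + 1) ≤ n := (Nat.mul_le_mul_right _ hlow).trans hn
    obtain ⟨e, rfl⟩ := Nat.exists_eq_add_of_le hd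
    nlinarith
  · have h1 := weightCount_le_exp (Nat.succ_pos (k + 1)) hupp
    have h2 := exp_mul_factorial_le_pow hk4
    have h3 : (((k + 1).factorial * k.factorial * weightCount (2 * N) N : ℕ) : ℝ) ≤
        ((63 * (k + 1) * (k + 2)) ^ k : ℕ) := by
      refine le_trans ?_ h2
      rw [Nat.cast_mul, mul_comm]
      gcongr
    exact_mod_cast h3

theorem weightCount_le_of_exp_le {N K m C : ℕ} (hK : 0 < K) (hN : N ≤ K ^ 2) (hm : 11 * K ≤ 3 * m)
    (hC : (2.7182818286 : ℝ) ^ m ≤ C) : weightCount (2 * N) N ≤ C := by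
  have hm' : (11 : ℝ) * K ≤ 3 * m := by exact_mod_cast hm
  have h : (weightCount (2 * N) N : ℝ) ≤ C :=
    ((weightCount_le_exp hK hN).trans (Real.exp_le_exp.2 (by linarith))).trans
      ((exp_natCast_le_pow m).trans hC)
  exact_mod_cast h

theorem weightCount_le_of_lt_five {N : ℕ} (hN : N < 5) : weightCount (2 * N) N ≤ 62 := by
  revert N
  decide +kernel

theorem weightCount_le_of_lt_thirteen {N : ℕ} (hN : N < 13) : weightCount (2 * N) N ≤ 5250 := by
  revert N
  decide +kernel

theorem weightCount_le_qNum {d n N : ℕ} (hd : 126 ≤ d) (hN : 2 ≤ N) (hn : N * (d + 1) ≤ n) :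
    weightCount (2 * N) N ≤ qNum 2 d n := by
  have hmul : ∀ M ≤ N, M * (d + 1) ≤ n := fun M hM => (Nat.mul_le_mul_right _ hM).trans hn
  rcases le_or_gt 25 N with h25 | h25
  · exact weightCount_le_qNum_of_large hd h25 hn
  rcases le_or_gt 17 N with h17 | h17
  · have hw : weightCount (2 * N) N ≤ 200000000 :=
      weightCount_le_of_exp_le (K := 5) (m := 19) (by norm_num) (by omega) (by norm_num)
        (by norm_num)
    have := hmul 17 h17
    have hc : Nat.choose (4 + 1) 2 = 10 := rfl
    refine hw.trans (le_qNum_of_mul_le_pow (k := 4) (t := 889) ?_ (by norm_num [Nat.factorial]))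
    rw [hc]
    omega
  rcases le_or_gt 13 N with h13 | h13
  · have hw : weightCount (2 * N) N ≤ 4000000 :=
      weightCount_le_of_exp_le (K := 4) (m := 15) (by norm_num) (by omega) (by norm_num)
        (by norm_num)
    have := hmul 13 h13
    have hc : Nat.choose (3 + 1) 2 = 6 := rfl
    refine hw.trans (le_qNum_of_mul_le_pow (k := 3) (t := 887) ?_ (by norm_num [Nat.factorial]))
    rw [hc]
    omega
  rcases le_or_gt 5 N with h5 | h5
  · have := hmul 5 h5
    have hc : Nat.choose (2 + 1) 2 = 3 := rfl
    refine (weightCount_le_of_lt_thirteen h13).trans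
      (le_qNum_of_mul_le_pow (k := 2) (t := 251) ?_ (by norm_num [Nat.factorial]))
    rw [hc]
    omega
  · have := hmul 2 hN
    have hc : Nat.choose (1 + 1) 2 = 1 := rfl
    refine (weightCount_le_of_lt_five h5).trans
      (le_qNum_of_mul_le_pow (k := 1) (t := 124) ?_ (by norm_num [Nat.factorial]))
    rw [hc]
    omega

theorem QNum_le_qNum {d n : ℕ} (hd : 126 ≤ d) (hn : d + 7 ≤ n) : QNum 2 d n ≤ qNum 2 d n := by
  refine (QNum_le_weightCount (by omega)).trans ?_
  have h1 : 1 ≤ n / (d + 1) := (Nat.one_le_div_iff (by omega)).2 (by omega)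
  rcases h1.eq_or_lt with h | h
  · rw [← h]
    exact le_trans (by decide) (three_le_qNum hn)
  · exact weightCount_le_qNum hd h (Nat.div_mul_le_self n (d + 1))

theorem alder_two_even_power (r d n : ℕ) (hr : 7 ≤ r) (hd : d = 2 ^ r - 2)
    (hn : d + 7 ≤ n) :
    QNum 2 d n ≤ qNum 2 d n := by
  have h : 2 ^ 7 ≤ 2 ^ r := Nat.pow_le_pow_right two_pos hr
  exact QNum_le_qNum (by omega) hn
end

section
/- Let d ≥ 253 be an odd integer. Then for every even integer n ≥ d+9, q_d^{(2)}(n) ≥ Q_d^{(2)}(n). -/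
/-- The `l`-th largest part of the partition into `k + 1` parts, with gaps at least `d` and
smallest part at least `2`, in which the `l + 1` largest parts are raised by `m l` each. -/
def gapPart (d k : ℕ) (m : ℕ → ℕ) (l : ℕ) : ℕ :=
  2 + d * (k - l) + ∑ i ∈ Finset.Ico l (k + 1), m i

lemma gapPart_succ (d k : ℕ) (m : ℕ → ℕ) {l : ℕ} (hl : l < k) :
    gapPart d k m l = gapPart d k m (l + 1) + d + m l := by
  unfold gapPart
  rw [Finset.sum_eq_sum_Ico_succ_bot (by omega : l < k + 1)]
  obtain ⟨e, rfl⟩ : ∃ e, k = l + 1 + e := ⟨k - (l + 1), by omega⟩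
  rw [show l + 1 + e - l = e + 1 by omega, show l + 1 + e - (l + 1) = e by omega]
  ring

lemma gapPart_last (d k : ℕ) (m : ℕ → ℕ) : gapPart d k m k = 2 + m k := by
  simp [gapPart]

lemma gapPart_add_le (d k : ℕ) (m : ℕ → ℕ) {l l' : ℕ} (h : l < l') (h' : l' ≤ k) :
    gapPart d k m l' + d ≤ gapPart d k m l := by
  induction l', h using Nat.le_induction with
  | base =>
    have := gapPart_succ d k m (by omega : l < k)
    rw [Nat.succ_eq_add_one]
    omega
  | succ j hj ih =>
    have := gapPart_succ d k m (by omega : j < k)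
    have := ih (by omega)
    omega

lemma two_mul_sum_gapPart (d k : ℕ) (m : ℕ → ℕ) :
    2 * ∑ l ∈ Finset.range (k + 1), gapPart d k m l =
      4 * (k + 1) + d * (k * (k + 1)) + 2 * ∑ i ∈ Finset.range (k + 1), (i + 1) * m i := by
  have h1 : ∑ l ∈ Finset.range (k + 1), (k - l) = ∑ l ∈ Finset.range (k + 1), l := by
    simpa using Finset.sum_range_reflect (fun l => l) (k + 1)
  have h2 := Finset.sum_range_id_mul_two (k + 1)
  have h3 : ∑ l ∈ Finset.range (k + 1), ∑ i ∈ Finset.Ico l (k + 1), m i =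
      ∑ i ∈ Finset.range (k + 1), (i + 1) * m i := by
    rw [Finset.sum_comm' (t' := Finset.range (k + 1)) (s' := fun i => Finset.range (i + 1))]
    · simp
    · intro x y
      simp only [Finset.mem_range, Finset.mem_Ico]
      omega
  simp only [gapPart, Finset.sum_add_distrib, ← Finset.mul_sum, h1, h3]
  simp only [Finset.sum_const, Finset.card_range, smul_eq_mul, Nat.add_sub_cancel] at h2 ⊢
  linear_combination d * h2

/-- The partition with parts `gapPart d k m l` for `l ≤ k`. -/
def gapPartition (d k n : ℕ) (m : ℕ → ℕ)
    (h : ∑ l ∈ Finset.range (k + 1), gapPart d k m l = n) : n.Partition where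
  parts := ((List.range (k + 1)).map (gapPart d k m) : List ℕ)
  parts_pos := by
    intro i hi
    simp only [Multiset.mem_coe, List.mem_map] at hi
    obtain ⟨l, -, rfl⟩ := hi
    unfold gapPart
    omega
  parts_sum := by
    rw [← h, Multiset.sum_coe]
    rfl

lemma pairwise_gapPart (d k : ℕ) (m : ℕ → ℕ) :
    ((List.range (k + 1)).map (gapPart d k m)).Pairwise (fun x y => y + d ≤ x) := by
  rw [List.pairwise_map]
  refine List.Pairwise.imp_of_mem ?_ List.pairwise_lt_range
  intro a b _ hb hab
  exact gapPart_add_le d k m hab (by simpa [Nat.lt_succ_iff] using hb)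

lemma gapPartition_mem (d k n : ℕ) (m : ℕ → ℕ)
    (h : ∑ l ∈ Finset.range (k + 1), gapPart d k m l = n) :
    (∀ x ∈ (gapPartition d k n m h).parts, 2 ≤ x) ∧
      (gapPartition d k n m h).parts.Pairwise (fun x y => d ≤ max x y - min x y) := by
  refine ⟨?_, _, rfl, (pairwise_gapPart d k m).imp (by intro x y h; omega)⟩
  intro x hx
  simp only [gapPartition, Multiset.mem_coe, List.mem_map] at hx
  obtain ⟨l, -, rfl⟩ := hx
  unfold gapPart
  omega

lemma eq_of_gapPartition_eq {d k n : ℕ} (hd : 0 < d) {m m' : ℕ → ℕ}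
    {h : ∑ l ∈ Finset.range (k + 1), gapPart d k m l = n}
    {h' : ∑ l ∈ Finset.range (k + 1), gapPart d k m' l = n}
    (heq : gapPartition d k n m h = gapPartition d k n m' h') {i : ℕ} (hi : i ≤ k) :
    m i = m' i := by
  have hp : ((List.range (k + 1)).map (gapPart d k m)).Perm
      ((List.range (k + 1)).map (gapPart d k m')) :=
    Multiset.coe_eq_coe.1 (congrArg Nat.Partition.parts heq)
  have hl := hp.eq_of_pairwise (le := fun x y => y + d ≤ x) (fun a b _ _ h1 h2 => by omega)
    (pairwise_gapPart d k m) (pairwise_gapPart d k m')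
  have key : ∀ l ≤ k, gapPart d k m l = gapPart d k m' l := fun l hl' =>
    List.map_inj_left.1 hl l (by simpa [Nat.lt_succ_iff] using hl')
  rcases hi.lt_or_eq with hi | rfl
  · have h1 := gapPart_succ d k m hi
    have h2 := gapPart_succ d k m' hi
    have h3 := key i hi.le
    have h4 := key (i + 1) hi
    omega
  · have := key i le_rfl
    rw [gapPart_last, gapPart_last] at this
    omega

/-- Multiplicities `g i` of the sizes `i + 2`, completed by the multiplicity of the size `1` that
makes the total equal to `N`. -/
def completeMult {k : ℕ} (N : ℕ) (g : Fin k → ℕ) : ℕ → ℕ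
  | 0 => N - ∑ i, (i.val + 2) * g i
  | i + 1 => if h : i < k then g ⟨i, h⟩ else 0

lemma sum_completeMult {k N : ℕ} {g : Fin k → ℕ} (hg : ∑ i, (i.val + 2) * g i ≤ N) :
    ∑ i ∈ Finset.range (k + 1), (i + 1) * completeMult N g i = N := by
  rw [Finset.sum_range_succ', Finset.sum_range]
  simp only [completeMult, Fin.is_lt, dite_true, Fin.eta, zero_add, one_mul, add_assoc,
    Nat.reduceAdd]
  omega

lemma prod_add_one_le_qNum {d k n N : ℕ} (hd : 0 < d) (hk : 0 < k)
    (hN : 2 * n = 4 * (k + 1) + d * (k * (k + 1)) + 2 * N) :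
    (∏ i ∈ Finset.range k, (N / k / (i + 2) + 1)) + 1 ≤ qNum 2 d n := by
  classical
  set F := Fintype.piFinset (fun i : Fin k => Finset.range (N / k / (i.val + 2) + 1)) with hF
  have hcard : Fintype.card (Option F) =
      (∏ i ∈ Finset.range k, (N / k / (i + 2) + 1)) + 1 := by
    rw [Fintype.card_option, Fintype.card_coe, hF, Fintype.card_piFinset, Finset.prod_range]
    simp
  have hsum : ∀ g ∈ F, ∑ i, (i.val + 2) * g i ≤ N := by
    intro g hg
    have hg' : ∀ i : Fin k, (i.val + 2) * g i ≤ N / k := by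
      intro i
      have := Fintype.mem_piFinset.1 hg i
      rw [Finset.mem_range, Nat.lt_succ_iff] at this
      exact (Nat.mul_le_mul_left _ this).trans (Nat.mul_div_le _ _)
    calc ∑ i, (i.val + 2) * g i ≤ ∑ _i : Fin k, N / k := Finset.sum_le_sum fun i _ => hg' i
      _ = k * (N / k) := by simp
      _ ≤ N := Nat.mul_div_le _ _
  have htot : ∀ g ∈ F,
      ∑ l ∈ Finset.range (k + 1), gapPart d k (completeMult N g) l = n := by
    intro g hg
    have := two_mul_sum_gapPart d k (completeMult N g)
    rw [sum_completeMult (hsum g hg)] at this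
    omega
  have hn : 0 < n := by omega
  let φ : Option F → {p : n.Partition //
      (∀ x ∈ p.parts, 2 ≤ x) ∧ p.parts.Pairwise (fun x y => d ≤ max x y - min x y)} := fun o =>
    match o with
    | none => ⟨Nat.Partition.indiscrete n, by
        rw [Nat.Partition.indiscrete_parts hn.ne']
        exact ⟨by intro x hx; rw [Multiset.mem_singleton] at hx; omega, [n], rfl, by simp⟩⟩
    | some g => ⟨gapPartition d k n _ (htot g.1 g.2), gapPartition_mem ..⟩
  have hne : ∀ g : F, φ none ≠ φ (some g) := by
    intro g h
    have h1 := congrArg (fun p => Multiset.card p.1.parts) h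
    simp only [φ, Nat.Partition.indiscrete_parts hn.ne', gapPartition, Multiset.coe_card,
      Multiset.card_singleton, List.length_map, List.length_range] at h1
    omega
  have hφ : Function.Injective φ := by
    rintro (_ | g) (_ | g') h
    · rfl
    · exact (hne g' h).elim
    · exact (hne g h.symm).elim
    · congr 1
      refine Subtype.ext (funext fun i => ?_)
      have := eq_of_gapPartition_eq hd (h := htot g.1 g.2) (h' := htot g'.1 g'.2)
        (congrArg Subtype.val h) (i := i.val + 1) i.2
      simpa [completeMult] using this
  rw [← hcard, ← Nat.card_eq_fintype_card]
  exact Nat.card_le_card_of_injective φ hφ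

/-- The parts congruent to `±2` modulo `d + 3`, other than `2` itself. -/
def bigPart (d : ℕ) (c : ℕ × Bool) : ℕ :=
  if c.2 then (c.1 + 1) * (d + 3) + 2 else (c.1 + 1) * (d + 3) - 2

lemma le_bigPart (d : ℕ) (c : ℕ × Bool) : (c.1 + 1) * (d + 1) ≤ bigPart d c := by
  obtain ⟨c, s⟩ := c
  have h : (c + 1) * (d + 3) = (c + 1) * (d + 1) + (c + 1) * 2 := by ring
  cases s <;> simp [bigPart] <;> omega

lemma bigPart_injective {d : ℕ} (hd : 1 < d) : Function.Injective (bigPart d) := by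
  have aux : ∀ a b : ℕ, a < b → (a + 1) * (d + 3) + 4 < (b + 1) * (d + 3) := by
    intro a b h
    nlinarith
  rintro ⟨a, s⟩ ⟨b, t⟩ h
  have ha : d + 3 ≤ (a + 1) * (d + 3) := Nat.le_mul_of_pos_left _ (by omega)
  have hb : d + 3 ≤ (b + 1) * (d + 3) := Nat.le_mul_of_pos_left _ (by omega)
  rcases lt_trichotomy a b with hab | rfl | hab
  · have := aux a b hab
    cases s <;> cases t <;> simp [bigPart] at h <;> omega
  · cases s <;> cases t <;> simp [bigPart] at h ⊢ <;> omega
  · have := aux b a hab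
    cases s <;> cases t <;> simp [bigPart] at h <;> omega

lemma exists_bigPart {d x : ℕ} (hx : 0 < x) (hx2 : x ≠ 2) (hd : 1 < d)
    (h : x % (d + 3) = 2 % (d + 3) ∨ (x + 2) % (d + 3) = 0) :
    ∃ c, bigPart d c = x := by
  rcases h with h | h
  · rw [Nat.mod_eq_of_lt (by omega : 2 < d + 3)] at h
    have h1 := Nat.div_add_mod x (d + 3)
    rcases Nat.eq_zero_or_pos (x / (d + 3)) with h0 | h0
    · rw [h0] at h1; omega
    · refine ⟨(x / (d + 3) - 1, true), ?_⟩
      simp only [bigPart, if_true, Nat.sub_add_cancel h0]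
      rw [mul_comm]; omega
  · have h1 := Nat.div_add_mod (x + 2) (d + 3)
    rcases Nat.eq_zero_or_pos ((x + 2) / (d + 3)) with h0 | h0
    · rw [h0] at h1; omega
    · refine ⟨((x + 2) / (d + 3) - 1, false), ?_⟩
      simp only [bigPart, Nat.sub_add_cancel h0]
      rw [mul_comm]
      simp only [Bool.false_eq_true, if_false]
      omega

lemma sum_count_mul_le_sum {ι : Type*} [Fintype ι] (f : ι → ℕ) (hf : Function.Injective f)
    (s : Multiset ℕ) : ∑ i, s.count (f i) * f i ≤ s.sum := by
  classical
  rw [Finset.sum_multiset_count_of_subset s (s.toFinset ∪ Finset.univ.image f)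
    Finset.subset_union_left]
  rw [← Finset.sum_image (f := fun m => s.count m * m) (g := f) (s := Finset.univ)
    (hf.injOn)]
  exact Finset.sum_le_sum_of_subset Finset.subset_union_right

lemma Multiset.eq_of_count_eq_of_sum_eq {a : ℕ} (ha : 0 < a) {s t : Multiset ℕ}
    (h : ∀ x ≠ a, s.count x = t.count x) (hsum : s.sum = t.sum) : s = t := by
  have hs := Multiset.filter_add_not (fun x => x = a) s
  have ht := Multiset.filter_add_not (fun x => x = a) t
  have hne : s.filter (fun x => ¬ x = a) = t.filter (fun x => ¬ x = a) := by
    ext x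
    by_cases hx : x = a
    · simp [hx]
    · simp [hx, h x hx]
  rw [Multiset.filter_eq', hne] at hs
  rw [Multiset.filter_eq'] at ht
  have h1 := congrArg Multiset.sum hs
  have h2 := congrArg Multiset.sum ht
  simp only [Multiset.sum_add, Multiset.sum_replicate, smul_eq_mul] at h1 h2
  have : s.count a = t.count a := Nat.eq_of_mul_eq_mul_right ha (by omega)
  rw [← hs, this, ht]

lemma QNum_mul_pow_le {d n : ℕ} (hd : 1 < d) {x : ℝ} (hx : 0 < x) (hx1 : x ≤ 1) :
    (QNum 2 d n : ℝ) * x ^ (n / (d + 1)) ≤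
      (∏ c ∈ Finset.range (n / (d + 1)),
        ∑ j ∈ Finset.range (n / (d + 1) + 1), (x ^ (c + 1)) ^ j) ^ 2 := by
  classical
  set T := n / (d + 1) with hT
  let val : Fin T × Bool → ℕ := fun c => bigPart d (c.1, c.2)
  have hval : Function.Injective val := by
    rintro ⟨a, s⟩ ⟨b, t⟩ h
    have := bigPart_injective hd h
    simpa [Fin.ext_iff] using this
  let A := {p : n.Partition //
    ∀ x ∈ p.parts, x % (d + 3) = 2 % (d + 3) ∨ (x + 2) % (d + 3) = 0}
  let φ : A → (Fin T × Bool → ℕ) := fun p c => p.1.parts.count (val c)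
  have hweight : ∀ p : A, ∑ c, φ p c * (c.1.val + 1) ≤ T := by
    intro p
    refine (Nat.le_div_iff_mul_le (by omega)).2 ?_
    rw [Finset.sum_mul]
    refine le_trans (Finset.sum_le_sum fun c _ => ?_)
      ((sum_count_mul_le_sum val hval p.1.parts).trans_eq p.1.parts_sum)
    rw [mul_assoc]
    exact Nat.mul_le_mul_left _ (le_bigPart d (c.1, c.2))
  have hle : ∀ x ≤ n, ∀ c, bigPart d c = x → c.1 < T := by
    rintro x hx c rfl
    exact (Nat.le_div_iff_mul_le (by omega)).2 ((le_bigPart d c).trans hx)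
  have hφ : Function.Injective φ := by
    intro p p' h
    refine Subtype.ext (Nat.Partition.ext
      (Multiset.eq_of_count_eq_of_sum_eq (a := 2) two_pos ?_
        (p.1.parts_sum.trans p'.1.parts_sum.symm)))
    intro x hx2
    by_cases hx : ∃ c : Fin T × Bool, val c = x
    · obtain ⟨c, rfl⟩ := hx
      exact congrFun h c
    · have h0 : ∀ r : A, r.1.parts.count x = 0 := by
        intro r
        rw [Multiset.count_eq_zero]
        intro hmem
        obtain ⟨c, hc⟩ := exists_bigPart (r.1.parts_pos hmem) hx2 hd (r.2 x hmem)
        have hxn : x ≤ n := (Multiset.single_le_sum (by simp) x hmem).trans_eq r.1.parts_sum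
        exact hx ⟨(⟨c.1, hle x hxn c hc⟩, c.2), hc⟩
      rw [h0, h0]
  have hmem : ∀ p : A, φ p ∈ Fintype.piFinset (fun _ : Fin T × Bool => Finset.range (T + 1)) := by
    intro p
    refine Fintype.mem_piFinset.2 fun c => Finset.mem_range_succ_iff.2 ?_
    refine le_trans ?_ (hweight p)
    refine le_trans ?_ (Finset.single_le_sum (f := fun c => φ p c * (c.1.val + 1))
      (fun _ _ => Nat.zero_le _) (Finset.mem_univ c))
    exact Nat.le_mul_of_pos_right _ (Nat.succ_pos _)
  have hterm : ∀ p : A, x ^ T ≤ ∏ c, (x ^ (c.1.val + 1)) ^ (φ p c) := by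
    intro p
    simp_rw [← pow_mul]
    rw [Finset.prod_pow_eq_pow_sum]
    refine pow_le_pow_of_le_one hx.le hx1 ((hweight p).trans' ?_)
    exact Finset.sum_le_sum fun c _ => (mul_comm _ _).le
  calc (QNum 2 d n : ℝ) * x ^ T = ∑ _p : A, x ^ T := by
        rw [Finset.sum_const, nsmul_eq_mul, Finset.card_univ, ← Nat.card_eq_fintype_card]
        rfl
    _ ≤ ∑ p : A, ∏ c, (x ^ (c.1.val + 1)) ^ (φ p c) := Finset.sum_le_sum fun p _ => hterm p
    _ = ∑ f ∈ Finset.univ.image φ, ∏ c, (x ^ (c.1.val + 1)) ^ (f c) := by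
        rw [Finset.sum_image hφ.injOn]
    _ ≤ ∑ f ∈ Fintype.piFinset (fun _ : Fin T × Bool => Finset.range (T + 1)),
          ∏ c, (x ^ (c.1.val + 1)) ^ (f c) := by
        refine Finset.sum_le_sum_of_subset_of_nonneg ?_ fun _ _ _ => by positivity
        intro f hf
        obtain ⟨p, -, rfl⟩ := Finset.mem_image.1 hf
        exact hmem p
    _ = ∏ c : Fin T × Bool, ∑ j ∈ Finset.range (T + 1), (x ^ (c.1.val + 1)) ^ j :=
        (Finset.prod_univ_sum _ _).symm
    _ = _ := by
        rw [Fintype.prod_prod_type, Finset.prod_range, ← Finset.prod_pow]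
        simp [sq]

lemma prod_inv_one_sub_pow_le {x : ℝ} (hx : 0 < x) (hx1 : x < 1) (T : ℕ) :
    ∏ c ∈ Finset.range T, (1 - x ^ (c + 1))⁻¹ ≤ Real.exp (Real.pi ^ 2 / 6 * (x / (1 - x))) := by
  have hlt : ∀ c : ℕ, x ^ (c + 1) < 1 := fun c => pow_lt_one₀ hx.le hx1 (Nat.succ_ne_zero c)
  rw [← Real.log_le_iff_le_exp (Finset.prod_pos fun c _ => inv_pos.2 (sub_pos.2 (hlt c)))]
  rw [Real.log_prod (fun c _ => (inv_pos.2 (sub_pos.2 (hlt c))).ne')]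
  have h1 : HasSum (fun j : ℕ => ∑ c ∈ Finset.range T, (x ^ (c + 1)) ^ (j + 1) / ((j : ℝ) + 1))
      (∑ c ∈ Finset.range T, Real.log (1 - x ^ (c + 1))⁻¹) := by
    refine hasSum_sum fun c _ => ?_
    rw [Real.log_inv]
    refine Real.hasSum_pow_div_log_of_abs_lt_one ?_
    rw [abs_of_pos (by positivity)]
    exact hlt c
  have h2 : HasSum (fun j : ℕ => 1 / ((j + 1 : ℕ) : ℝ) ^ 2 * (x / (1 - x)))
      (Real.pi ^ 2 / 6 * (x / (1 - x))) := by
    refine HasSum.mul_right _ ?_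
    have := (hasSum_nat_add_iff' (f := fun n : ℕ => 1 / (n : ℝ) ^ 2) 1).2 hasSum_zeta_two
    simpa using this
  refine hasSum_le (fun j => ?_) h1 h2
  have hsub : 0 < 1 - x := by linarith
  have hj : 0 < 1 - x ^ (j + 1) := sub_pos.2 (hlt j)
  have hgeom : ∑ c ∈ Finset.range T, (x ^ (c + 1)) ^ (j + 1) ≤
      x ^ (j + 1) / (1 - x ^ (j + 1)) := by
    have : ∀ c, (x ^ (c + 1)) ^ (j + 1) = x ^ (j + 1) * (x ^ (j + 1)) ^ c := by
      intro c; ring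
    simp_rw [this]
    rw [← Finset.mul_sum, div_eq_mul_inv]
    refine mul_le_mul_of_nonneg_left ?_ (by positivity)
    rw [geom_sum_eq (hlt j).ne, ← neg_div_neg_eq, neg_sub, neg_sub, ← one_div]
    gcongr
    linarith [show 0 ≤ (x ^ (j + 1)) ^ T by positivity]
  have hbern : x ^ (j + 1) / (1 - x ^ (j + 1)) ≤ x / (1 - x) / ((j : ℝ) + 1) := by
    have hb := one_add_mul_le_pow (a := x⁻¹ - 1)
      (by have := (one_lt_inv₀ hx).2 hx1; linarith) (j + 1)
    rw [add_sub_cancel, inv_pow] at hb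
    rw [div_div, div_le_div_iff₀ hj (by positivity)]
    have hb' := mul_le_mul_of_nonneg_left hb (show 0 ≤ x * x ^ (j + 1) by positivity)
    have e1 : x * x ^ (j + 1) * (x ^ (j + 1))⁻¹ = x := by field_simp
    have e2 : x * x ^ (j + 1) * (1 + ((j + 1 : ℕ) : ℝ) * (x⁻¹ - 1)) =
        x * x ^ (j + 1) + x ^ (j + 1) * ((1 - x) * ((j : ℝ) + 1)) := by
      push_cast; field_simp
    rw [e1, e2] at hb'
    linarith
  rw [← Finset.sum_div]
  calc _ ≤ x / (1 - x) / ((j : ℝ) + 1) / ((j : ℝ) + 1) := by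
        gcongr
        exact hgeom.trans hbern
    _ = _ := by
        push_cast; field_simp

lemma QNum_le_exp {d n : ℕ} (hd : 1 < d) {y : ℝ} (hy : 0 < y) :
    (QNum 2 d n : ℝ) ≤ (1 + 1 / y) ^ (n / (d + 1)) * Real.exp (3.29 * y) := by
  set x : ℝ := y / (1 + y) with hxdef
  have hx : 0 < x := by positivity
  have hx1 : x < 1 := by rw [hxdef, div_lt_one (by positivity)]; linarith
  have hxy : x / (1 - x) = y := by rw [hxdef]; field_simp; ring
  have hinv : 1 + 1 / y = x⁻¹ := by rw [hxdef]; field_simp; ring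
  have h := QNum_mul_pow_le (n := n) hd hx hx1.le
  set T := n / (d + 1)
  have hlt : ∀ c : ℕ, x ^ (c + 1) < 1 := fun c => pow_lt_one₀ hx.le hx1 (Nat.succ_ne_zero c)
  have hprod : ∏ c ∈ Finset.range T, ∑ j ∈ Finset.range (T + 1), (x ^ (c + 1)) ^ j ≤
      Real.exp (Real.pi ^ 2 / 6 * y) := by
    rw [← hxy]
    refine le_trans (Finset.prod_le_prod (fun c _ => by positivity) fun c _ => ?_)
      (prod_inv_one_sub_pow_le hx hx1 T)
    rw [geom_sum_eq (hlt c).ne, ← neg_div_neg_eq, neg_sub, neg_sub, ← one_div]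
    have := hlt c
    gcongr
    linarith [show 0 ≤ (x ^ (c + 1)) ^ (T + 1) by positivity]
  have hpi : 2 * (Real.pi ^ 2 / 6 * y) ≤ 3.29 * y := by
    have h1 := Real.pi_lt_d4
    have h2 := Real.pi_pos
    have h3 : Real.pi ^ 2 ≤ 9.87 := by nlinarith
    nlinarith
  rw [hinv, inv_pow, ← div_eq_inv_mul, le_div_iff₀ (by positivity)]
  calc _ ≤ _ := h
    _ ≤ Real.exp (Real.pi ^ 2 / 6 * y) ^ 2 := by
        gcongr
    _ ≤ _ := by
        rw [← Real.exp_nat_mul]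
        exact Real.exp_le_exp.2 (by exact_mod_cast hpi)

lemma QNum_le_four {d n : ℕ} (hd : 1 < d) (hT : n / (d + 1) = 1) : QNum 2 d n ≤ 4 := by
  have h := QNum_mul_pow_le (n := n) hd one_pos le_rfl
  rw [hT] at h
  norm_num at h
  exact_mod_cast h

lemma QNum_le_two_pow {d n : ℕ} (hd : 1 < d) : QNum 2 d n ≤ 27 * 2 ^ (n / (d + 1)) := by
  have h := QNum_le_exp (n := n) hd one_pos
  have he : Real.exp (3.29 * 1) ≤ 27 := by
    refine le_of_pow_le_pow_left₀ (n := 24) (by norm_num) (by norm_num) ?_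
    calc Real.exp (3.29 * 1) ^ 24 ≤ Real.exp 1 ^ 79 := by
          rw [← Real.exp_nat_mul, ← Real.exp_nat_mul]
          exact Real.exp_le_exp.2 (by norm_num)
      _ ≤ 2.7182818286 ^ 79 := by gcongr; exact Real.exp_one_lt_d9.le
      _ ≤ 27 ^ 24 := by norm_num
  have : (QNum 2 d n : ℝ) ≤ 27 * 2 ^ (n / (d + 1)) := by
    refine h.trans ?_
    rw [mul_comm]
    norm_num at he ⊢
    gcongr
  exact_mod_cast this

lemma prod_le_qNum_of_mul_le {d n : ℕ} (hd : 253 ≤ d) (k T N₀ : ℕ) (hk : 0 < k)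
    (hkT : k * (k + 1) ≤ 2 * T)
    (hN₀ : 4 * (k + 1) + 253 * (k * (k + 1)) + 2 * N₀ = 508 * T) (hn : T * (d + 1) ≤ n) :
    ∏ i ∈ Finset.range k, (N₀ / k / (i + 2) + 1) ≤ qNum 2 d n := by
  obtain ⟨t, ht⟩ := (Nat.even_mul_succ_self k).two_dvd
  obtain ⟨e, rfl⟩ := Nat.exists_eq_add_of_le hd
  rw [ht] at hkT hN₀
  have het : e * t ≤ e * T := Nat.mul_le_mul_left _ (by omega)
  have hle : 2 * (k + 1) + (253 + e) * t + N₀ ≤ n := by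
    refine le_trans ?_ hn
    linarith
  obtain ⟨N, rfl⟩ := Nat.exists_eq_add_of_le' ((Nat.le_add_right _ _).trans hle)
  refine le_trans ?_ ((Nat.le_succ _).trans
    (prod_add_one_le_qNum (N := N) (by omega : 0 < 253 + e) hk (by rw [ht]; ring)))
  have : N₀ ≤ N := by omega
  gcongr

lemma exp_le_prod {k : ℕ} (hk : 4 ≤ k) :
    Real.exp (11 / 3 * (k + 2)) ≤ ∏ i ∈ Finset.range k, (253 / 2 * ((k : ℝ) + 3) / (i + 2)) := by
  have he := Real.exp_one_lt_d9.le
  induction k, hk using Nat.le_induction with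
  | base =>
    calc Real.exp (11 / 3 * ((4 : ℕ) + 2)) = Real.exp 1 ^ 22 := by
          rw [← Real.exp_nat_mul]; norm_num
      _ ≤ 2.7182818286 ^ 22 := by gcongr
      _ ≤ _ := by norm_num [Finset.prod_range_succ]
  | succ k hk ih =>
    rw [Finset.prod_range_succ]
    have h1 : Real.exp (11 / 3) ≤ 253 / 2 := by
      calc Real.exp (11 / 3) ≤ Real.exp 1 ^ 4 := by
            rw [← Real.exp_nat_mul]; exact Real.exp_le_exp.2 (by norm_num)
        _ ≤ 2.7182818286 ^ 4 := by gcongr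
        _ ≤ _ := by norm_num
    have h2 : (253 / 2 : ℝ) ≤ 253 / 2 * (((k + 1 : ℕ) : ℝ) + 3) / (k + 2) := by
      rw [le_div_iff₀ (by positivity)]
      push_cast
      linarith
    calc Real.exp (11 / 3 * (((k + 1 : ℕ) : ℝ) + 2))
        = Real.exp (11 / 3 * (k + 2)) * Real.exp (11 / 3) := by
          rw [← Real.exp_add]; push_cast; ring_nf
      _ ≤ _ := by
          gcongr ?_ * ?_
          · refine ih.trans ?_
            gcongr
            linarith
          · exact h1.trans h2

lemma prod_le_qNum_of_sq_le {d n k : ℕ} (hd : 253 ≤ d) (hk : 0 < k)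
    (hn : (k + 1) ^ 2 * (d + 1) ≤ n) :
    ∏ i ∈ Finset.range k, (253 / 2 * ((k : ℝ) + 3) / (i + 2)) ≤ qNum 2 d n := by
  obtain ⟨t, ht⟩ := (Nat.even_mul_succ_self k).two_dvd
  have hle : 2 * (k + 1) + d * t ≤ n := by nlinarith
  obtain ⟨N, rfl⟩ := Nat.exists_eq_add_of_le' hle
  have hN : d * (k * (k + 3)) ≤ 2 * N := by nlinarith
  have hq := prod_add_one_le_qNum (n := N + (2 * (k + 1) + d * t)) (N := N) (d := d)
    (by omega) hk (by rw [ht]; ring)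
  have hk' : (0 : ℝ) < k := by exact_mod_cast hk
  have hN' : 253 / 2 * ((k : ℝ) + 3) ≤ (N : ℝ) / k := by
    rw [le_div_iff₀ hk']
    have h1 : (d : ℝ) * (k * (k + 3)) ≤ 2 * N := by exact_mod_cast hN
    have h2 : (253 : ℝ) ≤ d := by exact_mod_cast hd
    have h3 := mul_le_mul_of_nonneg_right h2 (show (0 : ℝ) ≤ k * (k + 3) by positivity)
    linarith
  calc _ ≤ ∏ i ∈ Finset.range k, (((N / k / (i + 2) + 1 : ℕ)) : ℝ) := by
        refine Finset.prod_le_prod (fun i _ => by positivity) fun i _ => ?_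
        rw [Nat.div_div_eq_div_mul]
        have h := (Nat.lt_floor_add_one ((N : ℝ) / ((k * (i + 2) : ℕ) : ℝ))).le
        rw [Nat.floor_div_eq_div] at h
        rw [Nat.cast_add_one]
        refine le_trans ?_ h
        push_cast
        rw [← div_div]
        gcongr
    _ ≤ _ := by exact_mod_cast (Nat.le_succ _).trans hq

lemma QNum_le_qNum_of_le_div {d n : ℕ} (hd : 253 ≤ d) (hT : 25 ≤ n / (d + 1)) :
    QNum 2 d n ≤ qNum 2 d n := by
  set T := n / (d + 1) with hTdef
  obtain ⟨k, hk⟩ : ∃ k, T.sqrt = k + 1 :=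
    Nat.exists_eq_add_one.2 ((Nat.sqrt_pos).2 (by omega))
  have hlo : (k + 1) ^ 2 ≤ T := hk ▸ Nat.sqrt_le' T
  have hhi : T < (k + 2) ^ 2 := by simpa [hk] using Nat.lt_succ_sqrt' T
  have hk4 : 4 ≤ k := by
    by_contra! h
    have : (k + 2) ^ 2 ≤ 5 ^ 2 := Nat.pow_le_pow_left (by omega) 2
    omega
  have hn : (k + 1) ^ 2 * (d + 1) ≤ n :=
    (Nat.mul_le_mul_right _ hlo).trans (Nat.div_mul_le_self n (d + 1))
  have hQ := QNum_le_exp (n := n) (d := d) (by omega) (y := ((k : ℝ) + 2) / 2) (by positivity)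
  have hq := prod_le_qNum_of_sq_le hd (by omega) hn
  have hT' : (T : ℝ) ≤ (k + 2) ^ 2 := by exact_mod_cast hhi.le
  have : (QNum 2 d n : ℝ) ≤ qNum 2 d n := by
    refine hQ.trans (le_trans ?_ ((exp_le_prod hk4).trans hq))
    calc _ ≤ Real.exp (1 / (((k : ℝ) + 2) / 2)) ^ T * Real.exp (3.29 * (((k : ℝ) + 2) / 2)) := by
          gcongr
          rw [add_comm]
          exact Real.add_one_le_exp _
      _ = Real.exp (T * (1 / (((k : ℝ) + 2) / 2)) + 3.29 * (((k : ℝ) + 2) / 2)) := by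
          rw [← Real.exp_nat_mul, ← Real.exp_add]
      _ ≤ _ := by
          refine Real.exp_le_exp.2 ?_
          have h1 : (T : ℝ) * (1 / (((k : ℝ) + 2) / 2)) ≤ 2 * (k + 2) := by
            rw [one_div_div, ← mul_div_assoc, div_le_iff₀ (by positivity)]
            nlinarith
          have : (0 : ℝ) ≤ k := by positivity
          linarith
  exact_mod_cast this

lemma QNum_le_qNum_of_div_mem {d n : ℕ} (hd : 253 ≤ d) (k T T' N₀ : ℕ) (hk : 0 < k)
    (hkT : k * (k + 1) ≤ 2 * T)
    (hN₀ : 4 * (k + 1) + 253 * (k * (k + 1)) + 2 * N₀ = 508 * T)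
    (hprod : 27 * 2 ^ T' ≤ ∏ i ∈ Finset.range k, (N₀ / k / (i + 2) + 1))
    (hlo : T ≤ n / (d + 1)) (hhi : n / (d + 1) ≤ T') :
    QNum 2 d n ≤ qNum 2 d n :=
  calc QNum 2 d n ≤ 27 * 2 ^ (n / (d + 1)) := QNum_le_two_pow (by omega)
    _ ≤ 27 * 2 ^ T' := by gcongr; norm_num
    _ ≤ _ := hprod
    _ ≤ _ := prod_le_qNum_of_mul_le hd k T N₀ hk hkT hN₀
      ((Nat.mul_le_mul_right _ hlo).trans (Nat.div_mul_le_self n (d + 1)))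

lemma four_le_qNum {d n : ℕ} (hd : 0 < d) (hn : d + 9 ≤ n) : 4 ≤ qNum 2 d n := by
  obtain ⟨N, rfl⟩ := Nat.exists_eq_add_of_le hn
  refine le_trans ?_ (prod_add_one_le_qNum (N := N + 5) (k := 1) hd one_pos (by ring))
  simp
  omega

theorem alder_two_odd (d n : ℕ) (hd : 253 ≤ d) (hdo : Odd d) (hne : Even n)
    (hn : d + 9 ≤ n) :
    QNum 2 d n ≤ qNum 2 d n := by
  have h1 : 1 ≤ n / (d + 1) := (Nat.le_div_iff_mul_le (by omega)).2 (by omega)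
  rcases h1.eq_or_lt with h | h2
  · exact (QNum_le_four (by omega) h.symm).trans (four_le_qNum (by omega) hn)
  rcases Nat.lt_or_ge (n / (d + 1)) 25 with h25 | h25
  swap
  · exact QNum_le_qNum_of_le_div hd h25
  rcases Nat.lt_or_ge (n / (d + 1)) 3 with h3 | h3
  · exact QNum_le_qNum_of_div_mem hd 1 2 2 251 (by decide) (by decide) (by decide) (by decide)
      h2 (by omega)
  rcases Nat.lt_or_ge (n / (d + 1)) 4 with h4 | h4
  · exact QNum_le_qNum_of_div_mem hd 1 3 3 505 (by decide) (by decide) (by decide) (by decide)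
      h3 (by omega)
  rcases Nat.lt_or_ge (n / (d + 1)) 6 with h6 | h6
  · exact QNum_le_qNum_of_div_mem hd 2 4 5 251 (by decide) (by decide) (by decide) (by decide)
      h4 (by omega)
  rcases Nat.lt_or_ge (n / (d + 1)) 9 with h9 | h9
  · exact QNum_le_qNum_of_div_mem hd 2 6 8 759 (by decide) (by decide) (by decide) (by decide)
      h6 (by omega)
  rcases Nat.lt_or_ge (n / (d + 1)) 12 with h12 | h12
  · exact QNum_le_qNum_of_div_mem hd 2 9 11 1521 (by decide) (by decide) (by decide) (by decide)
      h9 (by omega)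
  rcases Nat.lt_or_ge (n / (d + 1)) 18 with h18 | h18
  · exact QNum_le_qNum_of_div_mem hd 3 12 17 1522 (by decide) (by decide) (by decide) (by decide)
      h12 (by omega)
  · exact QNum_le_qNum_of_div_mem hd 4 18 24 2032 (by decide) (by decide) (by decide) (by decide)
      h18 (by omega)
end
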